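/- arXiv:1703.01919 — 2 statements merged into one kernel-verified Lean document; each statement's English description precedes it below -/
import Mathlib

section
/- Let k ≠ 0 and A, B, C be real numbers, let I ⊆ ℝ be an interval, and let φ : I → ℝ be differentiable with (1 + k·φ(t))·φ'(t) = A·φ(t)² + B·φ(t) + C for all t ∈ I. Define ω(t) = (φ(t) + 1/k)·e^{−(A/k)t}. Then ω is differentiable on I and ω(t)·ω'(t) = F₁(t)·ω(t) + F₀(t) for all t ∈ I, where F₀(t) = (C/k − B/k² + A/k³)·e^{−2(A/k)t} and F₁(t) = (B/k − 2A/k²)·e^{−(A/k)t}. -/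
/-- If `φ` solves `(1 + kφ)φ' = Aφ² + Bφ + C` on an interval `I` and
`ω(t) = (φ(t) + 1/k)e^{−(A/k)t}`, then `ω` is differentiable on `I` and satisfies
`ω·ω' = F₁·ω + F₀`, where `F₀(t) = (C/k − B/k² + A/k³)e^{−2(A/k)t}` and
`F₁(t) = (B/k − 2A/k²)e^{−(A/k)t}`. -/
theorem omega_transform (k A B C : ℝ) (hk : k ≠ 0) (I : Set ℝ)
    (hI : I.OrdConnected) (φ φ' : ℝ → ℝ)
    (hφ : ∀ t ∈ I, HasDerivAt φ (φ' t) t)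
    (hODE : ∀ t ∈ I, (1 + k * φ t) * φ' t = A * (φ t) ^ 2 + B * φ t + C) :
    ∀ t ∈ I, ∃ ω' : ℝ,
      HasDerivAt (fun s : ℝ => (φ s + 1 / k) * Real.exp (-(A / k) * s)) ω' t ∧
      (φ t + 1 / k) * Real.exp (-(A / k) * t) * ω'
        = (B / k - 2 * A / k ^ 2) * Real.exp (-(A / k) * t)
            * ((φ t + 1 / k) * Real.exp (-(A / k) * t))
          + (C / k - B / k ^ 2 + A / k ^ 3) * Real.exp (-2 * (A / k) * t) := by
  intro t ht
  have hexp : HasDerivAt (fun s : ℝ => Real.exp (-(A / k) * s))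
      (Real.exp (-(A / k) * t) * -(A / k)) t := by
    simpa using ((hasDerivAt_id t).const_mul (-(A / k))).exp
  refine ⟨_, ((hφ t ht).add_const (1 / k)).mul hexp, ?_⟩
  have hsq : Real.exp (-2 * (A / k) * t) = Real.exp (-(A / k) * t) ^ 2 := by
    rw [← Real.exp_nat_mul]
    congr 1
    push_cast
    ring
  have hquot : (φ t + 1 / k) * φ' t = (A * φ t ^ 2 + B * φ t + C) / k := by
    rw [← hODE t ht]
    field_simp
    ring
  rw [hsq]
  calc
    _ = Real.exp (-(A / k) * t) ^ 2 *
        ((φ t + 1 / k) * φ' t - A / k * (φ t + 1 / k) ^ 2) := by ring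
    _ = _ := by
      rw [hquot]
      field_simp
      ring
end

section
/- Let K ∈ ℝ, let J ⊆ ℝ be an interval on which τ² − τ − K ≠ 0, let G : J → ℝ be differentiable with G'(τ) = τ/(τ² − τ − K) for all τ ∈ J, and let h ∈ ℝ. Define ξ(τ) = h·e^{−G(τ)} and ω(τ) = τ·h·e^{−G(τ)}. Then for all τ ∈ J: ω(τ)·ω'(τ) = (ω(τ) + K·ξ(τ))·ξ'(τ). -/
/-- The parametric curve `ξ(τ) = h·e^{−G(τ)}`, `ω(τ) = τ·h·e^{−G(τ)}`, where
`G'(τ) = τ/(τ² − τ − K)` on `J`, satisfies `ω·ω' = (ω + Kξ)·ξ'` on `J`. -/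
theorem parametric_solution (K h : ℝ) (J : Set ℝ)
    (hJ : ∀ τ ∈ J, τ ^ 2 - τ - K ≠ 0) (G : ℝ → ℝ)
    (hG : ∀ τ ∈ J, HasDerivAt G (τ / (τ ^ 2 - τ - K)) τ) :
    ∀ τ ∈ J, ∃ dξ dω : ℝ,
      HasDerivAt (fun s : ℝ => h * Real.exp (-G s)) dξ τ ∧
      HasDerivAt (fun s : ℝ => s * h * Real.exp (-G s)) dω τ ∧
      (τ * h * Real.exp (-G τ)) * dω
        = (τ * h * Real.exp (-G τ) + K * (h * Real.exp (-G τ))) * dξ := by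
  intro τ hτ
  have hq : τ / (τ ^ 2 - τ - K) * (τ ^ 2 - τ - K) = τ := div_mul_cancel₀ τ (hJ τ hτ)
  have hE : HasDerivAt (fun s : ℝ => Real.exp (-G s))
      (Real.exp (-G τ) * -(τ / (τ ^ 2 - τ - K))) τ := (hG τ hτ).fun_neg.exp
  refine ⟨_, _, hE.const_mul h, ((hasDerivAt_id' τ).mul_const h).fun_mul hE, ?_⟩
  linear_combination -(h ^ 2 * Real.exp (-G τ) ^ 2) * hq
end
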